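/- Let W be a (n+1)-dimensional k-vector space with basis w_1,...,w_{n+1}, let a ∈ k, let τ be a permutation of {1,...,n+1}, and let g: W → W be defined by g(w_i) = a·w_{τ(i)}. Then the reversed characteristic polynomial of g equals ∏_i (1 - (aT)^{d_i}), where {d_i} are the cycle lengths of τ. -/

import Mathlib

open Polynomial

namespace Equiv.Perm

open Matrix

variable {α R : Type*} [DecidableEq α] [CommRing R]

/-- The permutation matrix of `σ`, with the columns indexed by fixed points of `σ` set to zero. -/
def supportMatrix (R : Type*) [CommRing R] (σ : Perm α) : Matrix α α R :=
  .of fun i j => if σ j = i ∧ σ j ≠ j then 1 else 0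

lemma one_sub_smul_supportMatrix_apply (σ : Perm α) (x : R) (i j : α) :
    (1 - x • supportMatrix R σ) i j = if i = j then 1 else if σ j = i then -x else 0 := by
  simp only [supportMatrix, Matrix.sub_apply, Matrix.smul_apply, Matrix.one_apply, of_apply,
    smul_eq_mul]
  split_ifs <;> simp_all

lemma supportMatrix_one : supportMatrix R (1 : Perm α) = 0 := by
  ext i j
  simp [supportMatrix]

lemma Disjoint.supportMatrix_mul_eq_add {σ τ : Perm α} (h : Disjoint σ τ) :
    supportMatrix R (σ * τ) = supportMatrix R σ + supportMatrix R τ := by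
  ext i j
  simp only [supportMatrix, of_apply, Matrix.add_apply, Perm.mul_apply]
  rcases h j with hj | hj
  · rcases h (τ j) with h' | h'
    · simp [hj, h']
    · have : τ j = j := τ.injective h'
      simp [hj, this]
  · simp [hj]

lemma IsCycle.eq_of_forall_apply_eq_or [Finite α] {σ π : Perm α} (hσ : σ.IsCycle)
    (h : ∀ i, π i = i ∨ π i = σ i) (hπ : π ≠ 1) : π = σ := by
  obtain ⟨i, hi⟩ : ∃ i, π i ≠ i := by
    contrapose! hπ
    exact Perm.ext hπ
  have hmoved : ∀ m : ℕ, π ((σ ^ m) i) ≠ (σ ^ m) i := by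
    intro m
    induction m with
    | zero => simpa using hi
    | succ m ih =>
      have hm := (h _).resolve_left ih
      rw [pow_succ', Perm.mul_apply, ← hm]
      exact fun e => ih (π.injective e)
  ext j
  by_cases hj : σ j = j
  · rcases h j with e | e <;> simp [e, hj]
  · have hi' : σ i ≠ i := by rwa [← (h i).resolve_left hi]
    obtain ⟨m, rfl⟩ := hσ.exists_pow_eq hi' hj
    exact (h _).resolve_left (hmoved m)

variable [Fintype α]

lemma Disjoint.supportMatrix_mul_supportMatrix {σ τ : Perm α} (h : Disjoint σ τ) :
    supportMatrix R σ * supportMatrix R τ = 0 := by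
  ext i j
  rw [Matrix.mul_apply]
  refine Finset.sum_eq_zero fun l _ => ?_
  simp only [supportMatrix, of_apply, mul_ite, mul_one, mul_zero]
  rcases h l with hl | hl
  · simp [hl]
  · rw [if_neg]
    rintro ⟨rfl, hj⟩
    exact hj (τ.injective hl)

lemma IsCycle.det_one_sub_smul_supportMatrix {σ : Perm α} (hσ : σ.IsCycle) (x : R) :
    (1 - x • supportMatrix R σ).det = 1 - x ^ σ.support.card := by
  rw [det_apply]
  simp only [one_sub_smul_supportMatrix_apply]
  rw [← Finset.sum_subset (Finset.subset_univ {1, σ}), Finset.sum_pair hσ.ne_one.symm]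
  · have hprod : ∏ i, (if σ i = i then 1 else if σ i = σ i then -x else 0) =
        (-x) ^ σ.support.card := by
      simp [Finset.prod_ite, support]
    rw [hprod, hσ.sign, neg_pow x]
    have hsq : ((-1 : R) ^ σ.support.card) * (-1) ^ σ.support.card = 1 := by
      rw [← mul_pow]; simp
    simp only [Units.smul_def, sign_one, one_smul, Perm.one_apply, if_true,
      Finset.prod_const_one, zsmul_eq_mul]
    push_cast
    linear_combination (-x ^ σ.support.card) * hsq
  · intro π _ hπ
    simp only [Finset.mem_insert, Finset.mem_singleton, not_or] at hπ
    obtain ⟨i, hi⟩ : ∃ i, ¬ (π i = i ∨ π i = σ i) := by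
      by_contra! h
      exact hπ.2 (hσ.eq_of_forall_apply_eq_or h hπ.1)
    rw [not_or] at hi
    rw [Finset.prod_eq_zero (Finset.mem_univ i), smul_zero]
    rw [if_neg hi.1, if_neg (Ne.symm hi.2)]

lemma det_one_sub_smul_supportMatrix (σ : Perm α) (x : R) :
    (1 - x • supportMatrix R σ).det = ∏ c ∈ σ.cycleFactorsFinset, (1 - x ^ c.support.card) := by
  induction σ using cycle_induction_on with
  | base_one => simp [supportMatrix_one]
  | base_cycles σ hσ =>
    rw [hσ.det_one_sub_smul_supportMatrix, hσ.cycleFactorsFinset_eq_singleton,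
      Finset.prod_singleton]
  | induction_disjoint σ τ h _ ihσ ihτ =>
    have hmul : 1 - x • supportMatrix R (σ * τ) =
        (1 - x • supportMatrix R σ) * (1 - x • supportMatrix R τ) := by
      simp only [h.supportMatrix_mul_eq_add, sub_mul, mul_sub, smul_mul_smul_comm,
        h.supportMatrix_mul_supportMatrix, mul_one, one_mul, smul_zero, smul_add]
      abel
    rw [hmul, det_mul, ihσ, ihτ, h.cycleFactorsFinset_mul_eq_union,
      Finset.prod_union h.disjoint_cycleFactorsFinset]

/-- The matrix of `w i ↦ w (σ i)` is `(σ⁻¹).permMatrix R`; this is its reversed characteristic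
polynomial, evaluated at `x`. -/
theorem det_one_sub_smul_permMatrix_inv (σ : Perm α) (x : R) :
    (1 - x • (σ⁻¹).permMatrix R).det =
      (∏ c ∈ σ.cycleFactorsFinset, (1 - x ^ c.support.card)) *
        (1 - x) ^ (Fintype.card α - σ.support.card) := by
  have hfactor : 1 - x • (σ⁻¹).permMatrix R =
      (1 - x • supportMatrix R σ) * diagonal fun j => if σ j = j then 1 - x else 1 := by
    ext i j
    have hij : σ⁻¹ i = j ↔ σ j = i := by rw [Perm.inv_eq_iff_eq, eq_comm]
    rw [mul_diagonal, one_sub_smul_supportMatrix_apply]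
    simp only [Matrix.sub_apply, Matrix.smul_apply, Matrix.one_apply, permMatrix,
      PEquiv.toMatrix_apply, toPEquiv_apply, Option.mem_some_iff, hij, smul_eq_mul]
    split_ifs <;> simp_all
  have hcard : (Finset.univ.filter fun j => σ j = j).card =
      Fintype.card α - σ.support.card := by
    rw [← Finset.card_compl]
    congr 1
    ext j
    simp
  rw [hfactor, det_mul, det_one_sub_smul_supportMatrix, det_diagonal, Finset.prod_ite,
    Finset.prod_const, Finset.prod_const_one, mul_one, hcard]

end Equiv.Perm

/-- Let `W = Fin (n+1) → k` be an `(n+1)`-dimensional `k`-vector space with standard basis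
`w 1, …, w (n+1)`, `a ∈ k`, `τ` a permutation of `{1, …, n+1}`, and `g : W →ₗ[k] W` defined by
`g (w i) = a • w (τ i)`. Then the reversed characteristic polynomial of `g` equals
`∏ (1 - (aT)^d)` over the cycle lengths `d` of `τ` (fixed points contributing
cycles of length 1). -/
theorem stmt_1 (n : ℕ) (k : Type*) [Field k] (a : k)
    (τ : Equiv.Perm (Fin (n + 1)))
    (g : (Fin (n + 1) → k) →ₗ[k] (Fin (n + 1) → k))
    (hg : ∀ i, g (Pi.single i (1 : k)) = a • (Pi.single (τ i) (1 : k) : Fin (n + 1) → k)) :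
    (LinearMap.charpoly g).reverse =
      (∏ c ∈ τ.cycleFactorsFinset, (1 - (C a * X) ^ c.support.card)) *
        (1 - C a * X) ^ (n + 1 - τ.support.card) := by
  have hmat : LinearMap.toMatrix' g = a • (τ⁻¹).permMatrix k := by
    ext i j
    simp [LinearMap.toMatrix'_apply, hg, PEquiv.toMatrix_apply, Pi.single_apply,
      Equiv.symm_apply_eq]
  have hmap : (X : k[X]) • (LinearMap.toMatrix' g).map C =
      (C a * X) • (τ⁻¹).permMatrix k[X] := by
    ext1 i j
    simp only [hmat, Matrix.smul_apply, Matrix.map_apply, Equiv.Perm.permMatrix,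
      PEquiv.toMatrix_apply, smul_eq_mul]
    split_ifs <;> simp [X_mul_C]
  rw [← LinearMap.charpoly_toMatrix g (Pi.basisFun k _), LinearMap.toMatrix_eq_toMatrix',
    Matrix.reverse_charpoly, Matrix.charpolyRev, hmap,
    Equiv.Perm.det_one_sub_smul_permMatrix_inv, Fintype.card_fin]
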